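/- arXiv:2510.21563 — 2 statements merged into one kernel-verified Lean document; each statement's English description precedes it below -/
import Mathlib

section
/- For any α ∈ [0, 1) there is a constant C_α, independent of ε > 0, such that for any drift u ∈ H_a and any 0 ≤ s ≤ t, ‖I_{s,t}^ε(u)‖²_{H^α(Ω_ε)} ≤ C_α (t − s)^{1−α} ∫_0^t ‖u_τ‖²_{L²(Ω_ε)} dτ. -/
open MeasureTheory Filter Set Topology
open scoped ENNReal NNReal

noncomputable section

lemma aux_cs {f : ℝ → ℝ} {g : ℝ → ℝ} {μ : Measure ℝ} (hf0 : ∀ x, 0 ≤ f x) (hg0 : ∀ x, 0 ≤ g x)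
    (hf : MemLp f 2 μ) (hg : MemLp g 2 μ) :
    (∫ x, f x * g x ∂μ) ^ 2 ≤ (∫ x, f x ^ 2 ∂μ) * ∫ x, g x ^ 2 ∂μ := by
  have h := integral_mul_le_Lp_mul_Lq_of_nonneg (μ := μ) (f := f) (g := g)
    Real.HolderConjugate.two_two (Eventually.of_forall hf0) (Eventually.of_forall hg0)
    (by simpa using hf) (by simpa using hg)
  simp only [Real.rpow_two, ← Real.sqrt_eq_rpow] at h
  have hF : 0 ≤ ∫ x, f x ^ 2 ∂μ := integral_nonneg fun x => sq_nonneg _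
  have hG : 0 ≤ ∫ x, g x ^ 2 ∂μ := integral_nonneg fun x => sq_nonneg _
  have h0 : 0 ≤ ∫ x, f x * g x ∂μ := integral_nonneg fun x => mul_nonneg (hf0 x) (hg0 x)
  calc _ ≤ (√(∫ x, f x ^ 2 ∂μ) * √(∫ x, g x ^ 2 ∂μ)) ^ 2 := pow_le_pow_left₀ h0 h 2
    _ = _ := by rw [mul_pow, Real.sq_sqrt hF, Real.sq_sqrt hG]

lemma aux_int {α s t : ℝ} (h0 : 0 ≤ α) (h1 : α < 1) (hs : 0 ≤ s) (hst : s ≤ t) :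
    ∫ τ in Ioc s t, τ ^ (-α) ≤ (t - s) ^ (1 - α) / (1 - α) := by
  rw [← intervalIntegral.integral_of_le hst, integral_rpow (Or.inl (by linarith))]
  have h2 : -α + 1 = 1 - α := by ring
  rw [h2]
  have := Real.rpow_add_le_add_rpow hs (sub_nonneg.2 hst) (p := 1 - α) (by linarith) (by linarith)
  rw [add_sub_cancel] at this
  exact div_le_div_of_nonneg_right (by linarith) (by linarith)

lemma aux_pt {α κ b a τ : ℝ} (h0 : 0 ≤ α) (h1 : α < 1) (hκ : 0 < κ) (hb : 1 ≤ b)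
    (ha : κ * b ≤ a) (hτ : 0 < τ) :
    b ^ α * ((τ * a + 1)⁻¹) ^ 2 ≤ κ ^ (-α) * τ ^ (-α) := by
  have hb0 : 0 < b := by linarith
  have hx : 0 < τ * (κ * b) := by positivity
  have hxa : τ * (κ * b) ≤ τ * a := by gcongr
  have hP : (τ * (κ * b)) ^ α ≤ (τ * a + 1) ^ 2 := by
    calc (τ * (κ * b)) ^ α ≤ (τ * a + 1) ^ α := by
          apply Real.rpow_le_rpow <;> linarith
      _ ≤ (τ * a + 1) ^ (2:ℝ) := by
          apply Real.rpow_le_rpow_of_exponent_le <;> linarith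
      _ = _ := Real.rpow_two _
  rw [Real.mul_rpow hτ.le (by positivity), Real.mul_rpow hκ.le hb0.le] at hP
  have e1 := Real.rpow_pos_of_pos hτ α
  have e2 := Real.rpow_pos_of_pos hκ α
  have hpos : 0 < (τ * a + 1) ^ 2 := by
    have : 0 < τ * a + 1 := by linarith
    positivity
  rw [Real.rpow_neg hκ.le, Real.rpow_neg hτ.le, inv_pow, ← mul_inv, ← div_eq_mul_inv,
    div_le_iff₀ hpos, ← div_eq_inv_mul, le_div_iff₀ (by positivity)]
  linarith

lemma aux_mode {α κ b a s t : ℝ} (h0 : 0 ≤ α) (h1 : α < 1) (hκ : 0 < κ) (hb : 1 ≤ b)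
    (ha : κ * b ≤ a) (hs : 0 ≤ s) (hst : s ≤ t) {v : ℝ → ℂ} (hv : Measurable v)
    (hi : IntegrableOn (fun τ => ‖v τ‖ ^ 2) (Icc 0 t) volume) :
    b ^ α * ‖∫ τ in Icc s t, (((τ * a + 1 : ℝ) : ℂ))⁻¹ * v τ‖ ^ 2 ≤
      κ ^ (-α) / (1 - α) * (t - s) ^ (1 - α) * ∫ τ in Icc 0 t, ‖v τ‖ ^ 2 := by
  have hb0 : 0 < b := by linarith
  have ha0 : 0 < a := lt_of_lt_of_le (by positivity) ha
  have hbα : 0 < b ^ α := Real.rpow_pos_of_pos hb0 α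
  have hκα : 0 < κ ^ (-α) := Real.rpow_pos_of_pos hκ _
  have hsub : Ioc s t ⊆ Icc 0 t := fun x hx => ⟨hs.trans hx.1.le, hx.2⟩
  rw [integral_Icc_eq_integral_Ioc]
  set μ := (volume : Measure ℝ).restrict (Ioc s t) with hμ
  have hmem : ∀ᵐ τ ∂μ, τ ∈ Ioc s t := ae_restrict_mem measurableSet_Ioc
  have hqm : Measurable (fun τ : ℝ => |(τ * a + 1)⁻¹|) := by fun_prop
  have hq2 : MemLp (fun τ : ℝ => |(τ * a + 1)⁻¹|) 2 μ := by
    apply MemLp.of_bound hqm.aestronglyMeasurable 1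
    filter_upwards [hmem] with τ hτ
    have : 0 ≤ τ * a := mul_nonneg (hs.trans hτ.1.le) ha0.le
    rw [Real.norm_eq_abs, abs_abs, abs_of_nonneg (by positivity)]
    exact inv_le_one_of_one_le₀ (by linarith)
  have hv2 : MemLp (fun τ : ℝ => ‖v τ‖) 2 μ := by
    rw [memLp_two_iff_integrable_sq hv.norm.aestronglyMeasurable]
    exact hi.mono_set hsub
  have hn : ‖∫ τ, (((τ * a + 1 : ℝ) : ℂ))⁻¹ * v τ ∂μ‖ ≤ ∫ τ, |(τ * a + 1)⁻¹| * ‖v τ‖ ∂μ := by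
    refine (norm_integral_le_integral_norm _).trans (le_of_eq ?_)
    congr 1
    ext τ
    rw [norm_mul, norm_inv, Complex.norm_real, Real.norm_eq_abs, abs_inv]
  have hcs := aux_cs (fun x => abs_nonneg _) (fun x => norm_nonneg _) hq2 hv2
  have hA : b ^ α * ∫ τ, |(τ * a + 1)⁻¹| ^ 2 ∂μ ≤ κ ^ (-α) * ((t - s) ^ (1 - α) / (1 - α)) := by
    have hint : Integrable (fun τ : ℝ => τ ^ (-α)) μ :=
      (intervalIntegrable_iff_integrableOn_Ioc_of_le hst).1
        (intervalIntegral.intervalIntegrable_rpow' (by linarith))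
    calc b ^ α * ∫ τ, |(τ * a + 1)⁻¹| ^ 2 ∂μ = ∫ τ, b ^ α * |(τ * a + 1)⁻¹| ^ 2 ∂μ :=
          (integral_const_mul _ _).symm
      _ ≤ ∫ τ, κ ^ (-α) * τ ^ (-α) ∂μ := by
          apply integral_mono_ae (hq2.integrable_sq.const_mul _) (hint.const_mul _)
          filter_upwards [hmem] with τ hτ
          simp only [sq_abs]
          exact aux_pt h0 h1 hκ hb ha (lt_of_le_of_lt hs hτ.1)
      _ = κ ^ (-α) * ∫ τ, τ ^ (-α) ∂μ := integral_const_mul _ _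
      _ ≤ _ := by
          gcongr
          exact aux_int h0 h1 hs hst
  have hB : ∫ τ, ‖v τ‖ ^ 2 ∂μ ≤ ∫ τ in Icc 0 t, ‖v τ‖ ^ 2 :=
    setIntegral_mono_set hi (Eventually.of_forall fun _ => sq_nonneg _) hsub.eventuallyLE
  have hB0 : 0 ≤ ∫ τ, ‖v τ‖ ^ 2 ∂μ := integral_nonneg fun _ => sq_nonneg _
  have hR : 0 ≤ κ ^ (-α) * ((t - s) ^ (1 - α) / (1 - α)) :=
    mul_nonneg hκα.le (div_nonneg (Real.rpow_nonneg (by linarith) _) (by linarith))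
  calc _ ≤ b ^ α * ((∫ τ, |(τ * a + 1)⁻¹| ^ 2 ∂μ) * ∫ τ, ‖v τ‖ ^ 2 ∂μ) := by
        gcongr
        exact (pow_le_pow_left₀ (norm_nonneg _) hn 2).trans hcs
    _ = (b ^ α * ∫ τ, |(τ * a + 1)⁻¹| ^ 2 ∂μ) * ∫ τ, ‖v τ‖ ^ 2 ∂μ := by ring
    _ ≤ (κ ^ (-α) * ((t - s) ^ (1 - α) / (1 - α))) * ∫ τ in Icc 0 t, ‖v τ‖ ^ 2 :=
        mul_le_mul hA hB hB0 hR
    _ = _ := by ring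

/-- (Lemma 4.3 of the paper), stated on the Fourier side.
For any `α ∈ [0,1)` there is a constant `C_α`, independent of the lattice spacing `ε`, such
that for any drift `u ∈ H_a` and any `0 ≤ s ≤ t`,
`‖I_{s,t}^ε(u)‖²_{H^α(Ω_ε)} ≤ C_α (t-s)^{1-α} ∫_0^t ‖u_τ‖²_{L²(Ω_ε)} dτ`.

Here the lattice is represented through its Fourier dual `Ω_ε^*`: a finite set `K` of
frequencies carrying `|k|²` (`normSq`) and the Fourier multipliers `-Δ̂^ε(k)` (`lam`) of the
lattice Laplacian, which satisfy `-Δ̂^ε(k) ≥ c |k|²` for a constant `c > 0` independent of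
`ε`.  For `û : [0,∞) → Ω_ε^* → ℂ` the Fourier coefficients of a drift, the multiplier of
`q_τ^ε = (ċ_τ^ε)^{1/2}` is `q̂_τ^ε(k) = (τ(-Δ̂^ε(k) + m²) + 1)⁻¹`, the Sobolev norm is
`‖f‖²_{H^α(Ω_ε)} = ∑_k (1+|k|²)^α |f̂(k)|²`, and by Parseval
`‖u_τ‖²_{L²(Ω_ε)} = ∑_k |û_τ(k)|²`. -/
theorem statement12
    (m clat : ℝ) (hm : 0 < m) (hclat : 0 < clat)
    (α : ℝ) (hα : 0 ≤ α ∧ α < 1) :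
    ∃ C : ℝ, 0 < C ∧
      ∀ (K : Type) [Fintype K] (normSq lam : K → ℝ),
        (∀ k, 0 ≤ normSq k) → (∀ k, clat * normSq k ≤ lam k) →
        ∀ u : ℝ → K → ℂ, (∀ k, Measurable fun τ => u τ k) →
        ∀ s t : ℝ, 0 ≤ s → s ≤ t →
        IntegrableOn (fun τ => ∑ k, ‖u τ k‖ ^ 2) (Icc 0 t) volume →
        (∑ k, (1 + normSq k) ^ α *
            ‖∫ τ in Icc s t, (((τ * (lam k + m ^ 2) + 1 : ℝ) : ℂ))⁻¹ * u τ k‖ ^ 2)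
          ≤ C * (t - s) ^ (1 - α) * ∫ τ in Icc 0 t, ∑ k, ‖u τ k‖ ^ 2 := by
  obtain ⟨h0, h1⟩ := hα
  have hκ : 0 < min clat (m ^ 2) := lt_min hclat (by positivity)
  refine ⟨(min clat (m ^ 2)) ^ (-α) / (1 - α),
    div_pos (Real.rpow_pos_of_pos hκ _) (by linarith), ?_⟩
  intro K _ normSq lam hn hl u hu s t hs hst hi
  have hik : ∀ k, IntegrableOn (fun τ => ‖u τ k‖ ^ 2) (Icc 0 t) volume := by
    intro k
    refine Integrable.mono' hi ((hu k).norm.pow_const 2).aestronglyMeasurable ?_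
    refine Eventually.of_forall fun τ => ?_
    rw [Real.norm_of_nonneg (sq_nonneg _)]
    exact Finset.single_le_sum (f := fun k => ‖u τ k‖ ^ 2) (fun _ _ => sq_nonneg _)
      (Finset.mem_univ k)
  rw [integral_finsetSum _ fun k _ => hik k, Finset.mul_sum]
  refine Finset.sum_le_sum fun k _ => ?_
  refine aux_mode h0 h1 hκ (by linarith [hn k]) ?_ hs hst (hu k) (hik k)
  have e1 : min clat (m ^ 2) * normSq k ≤ clat * normSq k :=
    mul_le_mul_of_nonneg_right (min_le_left _ _) (hn k)
  have e2 : min clat (m ^ 2) ≤ m ^ 2 := min_le_right _ _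
  nlinarith [hl k]
end
end

section
/- For any α ∈ (1, 2] there is a constant C_α, independent of ε > 0, such that for any drift u ∈ H_a and any 0 < s ≤ t, ‖I_{s,t}^ε(u)‖²_{H^α(Ω_ε)} ≤ C_α ((t − s)/s^α) ∫_s^t ‖u_τ‖²_{L²(Ω_ε)} dτ. -/
open MeasureTheory Filter Set Topology
open scoped ENNReal NNReal

noncomputable section

lemma cs_aux (f : ℝ → ℝ) (s t : ℝ) (hst : s ≤ t) (hf : IntegrableOn f (Icc s t) volume)
    (hf2 : IntegrableOn (fun τ => f τ ^ 2) (Icc s t) volume) :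
    (∫ τ in Icc s t, f τ) ^ 2 ≤ (t - s) * ∫ τ in Icc s t, f τ ^ 2 := by
  rcases hst.eq_or_lt with rfl | hlt
  · simp
  have hL : 0 < t - s := sub_pos.2 hlt
  set I := ∫ τ in Icc s t, f τ with hI
  have h0 : 0 ≤ ∫ τ in Icc s t, ((t - s) * f τ - I) ^ 2 :=
    integral_nonneg fun τ => sq_nonneg _
  have h1 : ∫ τ in Icc s t, ((t - s) * f τ - I) ^ 2
      = (t - s) ^ 2 * (∫ τ in Icc s t, f τ ^ 2) - 2 * (t - s) * I * I + (t - s) * I ^ 2 := by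
    have e : (fun τ => ((t - s) * f τ - I) ^ 2)
        = fun τ => ((t - s) ^ 2 * f τ ^ 2 - 2 * (t - s) * I * f τ) + I ^ 2 := by
      funext τ; ring
    have hc : IntegrableOn (fun _ : ℝ => I ^ 2) (Icc s t) volume := by
      apply integrableOn_const <;> simp
    have hd : IntegrableOn (fun τ => (t - s) ^ 2 * f τ ^ 2 - 2 * (t - s) * I * f τ)
        (Icc s t) volume := (hf2.const_mul _).sub (hf.const_mul _)
    rw [e, integral_add hd hc,
      integral_sub (hf2.const_mul _) (hf.const_mul _), integral_const_mul, integral_const_mul]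
    simp [hL.le, hst, ← hI]
  rw [h1] at h0
  have h2 : 0 ≤ (t - s) * ((t - s) * (∫ τ in Icc s t, f τ ^ 2) - I ^ 2) := by linarith
  linarith [nonneg_of_mul_nonneg_right h2 hL]

lemma mult_aux (a s X α : ℝ) (ha : 0 < a) (hs : 0 < s) (hX : 1 ≤ X) (h0 : 0 ≤ α)
    (h2 : α ≤ 2) :
    X ^ α * ((s * (a * X) + 1)⁻¹) ^ 2 ≤ a ^ (-α) / s ^ α := by
  have hX0 : 0 < X := by linarith
  have hp : 0 < s * (a * X) := by positivity
  have h : (s * (a * X)) ^ α ≤ (s * (a * X) + 1) ^ 2 := by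
    calc (s * (a * X)) ^ α ≤ (s * (a * X) + 1) ^ α :=
          Real.rpow_le_rpow hp.le (by linarith) h0
      _ ≤ (s * (a * X) + 1) ^ (2 : ℝ) := Real.rpow_le_rpow_of_exponent_le (by linarith) h2
      _ = _ := by norm_cast
  rw [Real.mul_rpow hs.le (by positivity), Real.mul_rpow ha.le hX0.le] at h
  have hsα := Real.rpow_pos_of_pos hs α
  have haα := Real.rpow_pos_of_pos ha α
  rw [Real.rpow_neg ha.le, inv_pow, ← div_eq_mul_inv, div_eq_mul_inv (a ^ α)⁻¹, ← mul_inv,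
    ← one_div, div_le_div_iff₀ (by positivity) (by positivity)]
  linarith

/-- (Lemma 4.4 of the paper), stated on the Fourier side.
For any `α ∈ (1,2]` there is a constant `C_α`, independent of the lattice spacing `ε`, such
that for any drift `u ∈ H_a` and any `0 < s ≤ t`,
`‖I_{s,t}^ε(u)‖²_{H^α(Ω_ε)} ≤ C_α ((t-s)/s^α) ∫_s^t ‖u_τ‖²_{L²(Ω_ε)} dτ`.

The lattice is represented through its Fourier dual `Ω_ε^*`: a finite set `K` of
frequencies carrying `|k|²` (`normSq`) and the Fourier multipliers `-Δ̂^ε(k)` (`lam`) of the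
lattice Laplacian, which satisfy `-Δ̂^ε(k) ≥ c |k|²` for a constant `c > 0` independent of
`ε`.  For `û : [0,∞) → Ω_ε^* → ℂ` the Fourier coefficients of a drift, the multiplier of
`q_τ^ε = (ċ_τ^ε)^{1/2}` is `q̂_τ^ε(k) = (τ(-Δ̂^ε(k) + m²) + 1)⁻¹`, the Sobolev norm is
`‖f‖²_{H^α(Ω_ε)} = ∑_k (1+|k|²)^α |f̂(k)|²`, and by Parseval
`‖u_τ‖²_{L²(Ω_ε)} = ∑_k |û_τ(k)|²`. -/
theorem statement13
    (m clat : ℝ) (hm : 0 < m) (hclat : 0 < clat)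
    (α : ℝ) (hα : 1 < α ∧ α ≤ 2) :
    ∃ C : ℝ, 0 < C ∧
      ∀ (K : Type) [Fintype K] (normSq lam : K → ℝ),
        (∀ k, 0 ≤ normSq k) → (∀ k, clat * normSq k ≤ lam k) →
        ∀ u : ℝ → K → ℂ, (∀ k, Measurable fun τ => u τ k) →
        ∀ s t : ℝ, 0 < s → s ≤ t →
        IntegrableOn (fun τ => ∑ k, ‖u τ k‖ ^ 2) (Icc s t) volume →
        (∑ k, (1 + normSq k) ^ α *
            ‖∫ τ in Icc s t, (((τ * (lam k + m ^ 2) + 1 : ℝ) : ℂ))⁻¹ * u τ k‖ ^ 2)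
          ≤ C * ((t - s) / s ^ α) * ∫ τ in Icc s t, ∑ k, ‖u τ k‖ ^ 2 := by
  set a := min clat (m ^ 2) with ha_def
  have ha : 0 < a := lt_min hclat (by positivity)
  refine ⟨a ^ (-α), Real.rpow_pos_of_pos ha _, ?_⟩
  intro K _ normSq lam hn hlam u hu s t hs hst hint
  have hk2 : ∀ k, IntegrableOn (fun τ => ‖u τ k‖ ^ 2) (Icc s t) volume := by
    intro k
    refine Integrable.mono' hint ((hu k).norm.pow_const 2).aestronglyMeasurable ?_
    filter_upwards with τ
    rw [Real.norm_of_nonneg (by positivity)]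
    exact Finset.single_le_sum (f := fun k => ‖u τ k‖ ^ 2) (fun i _ => by positivity)
      (Finset.mem_univ k)
  have hk1 : ∀ k, IntegrableOn (fun τ => ‖u τ k‖) (Icc s t) volume := by
    intro k
    have hc : IntegrableOn (fun _ : ℝ => (1 : ℝ)) (Icc s t) volume := by
      apply integrableOn_const <;> simp
    refine Integrable.mono' (hc.add (hk2 k)) (hu k).norm.aestronglyMeasurable ?_
    filter_upwards with τ
    simp only [norm_norm, Pi.add_apply]
    nlinarith [sq_nonneg (‖u τ k‖ - 1)]
  rw [integral_finsetSum _ (fun k _ => hk2 k), Finset.mul_sum]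
  refine Finset.sum_le_sum fun k _ => ?_
  set X := 1 + normSq k with hX
  have hX1 : 1 ≤ X := by linarith [hn k]
  have hl : a * X ≤ lam k + m ^ 2 := by
    have h1 : a * normSq k ≤ clat * normSq k :=
      mul_le_mul_of_nonneg_right (min_le_left _ _) (hn k)
    have h2 : a ≤ m ^ 2 := min_le_right _ _
    have h3 := hlam k
    rw [hX]; linarith
  have haX : 0 < a * X := by positivity
  set Q := (s * (a * X) + 1)⁻¹ with hQ
  have hQ0 : 0 ≤ Q := by positivity
  have hb : ‖∫ τ in Icc s t, (((τ * (lam k + m ^ 2) + 1 : ℝ) : ℂ))⁻¹ * u τ k‖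
      ≤ Q * ∫ τ in Icc s t, ‖u τ k‖ := by
    rw [← integral_const_mul]
    refine norm_integral_le_of_norm_le ((hk1 k).const_mul Q) ?_
    filter_upwards [ae_restrict_mem measurableSet_Icc] with τ hτ
    have hle : s * (a * X) ≤ τ * (lam k + m ^ 2) :=
      mul_le_mul hτ.1 hl haX.le (hs.le.trans hτ.1)
    have hp : 0 < s * (a * X) := by positivity
    rw [norm_mul, norm_inv, Complex.norm_real, Real.norm_of_nonneg (by linarith)]
    refine mul_le_mul_of_nonneg_right ?_ (norm_nonneg _)
    exact inv_anti₀ (by linarith) (by linarith)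
  have hcs := cs_aux (fun τ => ‖u τ k‖) s t hst (hk1 k) (hk2 k)
  have hm' := mult_aux a s X α ha hs hX1 (by linarith [hα.1]) hα.2
  have hJ : 0 ≤ (t - s) * ∫ τ in Icc s t, ‖u τ k‖ ^ 2 :=
    mul_nonneg (by linarith) (integral_nonneg fun τ => by positivity)
  have hXα : 0 ≤ X ^ α := Real.rpow_nonneg (by linarith) _
  calc _ ≤ X ^ α * (Q * ∫ τ in Icc s t, ‖u τ k‖) ^ 2 := by gcongr
    _ = (X ^ α * Q ^ 2) * (∫ τ in Icc s t, ‖u τ k‖) ^ 2 := by ring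
    _ ≤ (X ^ α * Q ^ 2) * ((t - s) * ∫ τ in Icc s t, ‖u τ k‖ ^ 2) :=
        mul_le_mul_of_nonneg_left hcs (by positivity)
    _ ≤ (a ^ (-α) / s ^ α) * ((t - s) * ∫ τ in Icc s t, ‖u τ k‖ ^ 2) :=
        mul_le_mul_of_nonneg_right hm' hJ
    _ = _ := by ring
end
end
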